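/- arXiv:1312.4192 — 8 statements merged into one kernel-verified Lean document; each statement's English description precedes it below -/
import Mathlib

section
/- Let a_1, a_2 be integers and set s = a_1 + a_2. In the quotient ring R = ℤ[u,v]/(u^3 − s·u^2v, v^2), the identity ((u − a_1v) + (u − a_2v) + u + v + v)^3 = 54·u^2v holds; equivalently, (3u + (2−s)v)^3 = 54·u^2v in R. -/
open MvPolynomial

theorem add_cube_eq_of_relations {R : Type*} [CommRing R] {a b u v : R}
    (hu : u ^ 3 = (a + b) * u ^ 2 * v) (hv : v ^ 2 = 0) :
    ((u - a * v) + (u - b * v) + u + v + v) ^ 3 = 54 * (u ^ 2 * v) := by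
  linear_combination 27 * hu + (9 * u * (2 - (a + b)) ^ 2 + (2 - (a + b)) ^ 3 * v) * hv

/-- In `R = ℤ[u,v]/(u³ - (a₁+a₂)u²v, v²)`, the cohomology ring of Kleinschmidt's toric
variety `X₃(a₁,a₂)`, the cube of the first Chern class
`(u - a₁v) + (u - a₂v) + u + v + v` equals `54·u²v`, i.e. `c₁³[X₃(a₁,a₂)] = 54`. -/
theorem stmt_2 (a₁ a₂ : ℤ) :
    let s : ℤ := a₁ + a₂
    let I : Ideal (MvPolynomial (Fin 2) ℤ) :=
      Ideal.span {X 0 ^ 3 - C s * X 0 ^ 2 * X 1, X 1 ^ 2}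
    let u : MvPolynomial (Fin 2) ℤ ⧸ I := Ideal.Quotient.mk I (X 0)
    let v : MvPolynomial (Fin 2) ℤ ⧸ I := Ideal.Quotient.mk I (X 1)
    ((u - (a₁ : MvPolynomial (Fin 2) ℤ ⧸ I) * v) + (u - (a₂ : MvPolynomial (Fin 2) ℤ ⧸ I) * v)
        + u + v + v) ^ 3 = 54 * (u ^ 2 * v) := by
  intro s I u v
  have hC : Ideal.Quotient.mk I (C s) = (a₁ : MvPolynomial (Fin 2) ℤ ⧸ I) + a₂ := by
    rw [← Int.cast_add]
    exact map_intCast ((Ideal.Quotient.mk I).comp C) s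
  have hu : u ^ 3 = (a₁ + a₂) * u ^ 2 * v := by
    have h : Ideal.Quotient.mk I (X 0 ^ 3) = Ideal.Quotient.mk I (C s * X 0 ^ 2 * X 1) :=
      Ideal.Quotient.eq.2 (Ideal.subset_span (Set.mem_insert _ _))
    rwa [map_pow, map_mul, map_mul, map_pow, hC] at h
  have hv : v ^ 2 = 0 := by
    have h : Ideal.Quotient.mk I (X 1 ^ 2) = 0 :=
      Ideal.Quotient.eq_zero_iff_mem.2 (Ideal.subset_span (Set.mem_insert_of_mem _ rfl))
    rwa [map_pow] at h
  exact add_cube_eq_of_relations hu hv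
end

section
/- Let a be an integer. In the quotient ring R = ℤ[u,v]/(u^2 − a·uv, v^3), the identity ((u − av) + u + v + v + v)^3 = (2a^2 + 54)·uv^2 holds; equivalently, (2u + (3−a)v)^3 = (2a^2+54)·uv^2 in R. -/
open MvPolynomial

/-- In `R = ℤ[u,v]/(u² - a·uv, v³)`, the cohomology ring of Kleinschmidt's toric
variety `X₃(a)`, the cube of the first Chern class `(u - av) + u + v + v + v`
equals `(2a² + 54)·uv²`, i.e. `c₁³[X₃(a)] = 2a² + 54`. -/
theorem stmt_3 (a : ℤ) :
    let I : Ideal (MvPolynomial (Fin 2) ℤ) :=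
      Ideal.span {X 0 ^ 2 - C a * X 0 * X 1, X 1 ^ 3}
    let u : MvPolynomial (Fin 2) ℤ ⧸ I := Ideal.Quotient.mk I (X 0)
    let v : MvPolynomial (Fin 2) ℤ ⧸ I := Ideal.Quotient.mk I (X 1)
    ((u - (a : MvPolynomial (Fin 2) ℤ ⧸ I) * v) + u + v + v + v) ^ 3
      = (2 * (a : MvPolynomial (Fin 2) ℤ ⧸ I) ^ 2 + 54) * (u * v ^ 2) := by
  intro I u v
  have hu : u ^ 2 - (a : MvPolynomial (Fin 2) ℤ ⧸ I) * u * v = 0 := by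
    have h : Ideal.Quotient.mk I (X 0 ^ 2 - C a * X 0 * X 1) = 0 :=
      Ideal.Quotient.eq_zero_iff_mem.mpr (Ideal.subset_span (by simp))
    have hC : (C a : MvPolynomial (Fin 2) ℤ) = (a : MvPolynomial (Fin 2) ℤ) :=
      eq_intCast C a
    rwa [hC, map_sub, map_mul, map_mul, map_pow, map_intCast] at h
  have hv : v ^ 3 = 0 := by
    have h : Ideal.Quotient.mk I (X 1 ^ 3) = 0 :=
      Ideal.Quotient.eq_zero_iff_mem.mpr (Ideal.subset_span (by simp))
    rwa [map_pow] at h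
  generalize (a : MvPolynomial (Fin 2) ℤ ⧸ I) = b at hu ⊢
  linear_combination (8 * u + (36 - 4 * b) * v) * hu + (3 - b) ^ 3 * hv
end

section
/- Let a be an integer and let R = ℤ[u,v,w]/(u^2, v^2 − a·uv, w^2 − vw). Consider the six elements A_1 = u, A_2 = u, B_1 = v − au, B_2 = v, C_1 = w − v, C_2 = w of R, and let σ_k denote the k-th elementary symmetric polynomial evaluated at these six elements. Then in R: σ_1^3 = (48 + 2a)·uvw, σ_1·σ_2 = 24·uvw, and σ_3 = 8·uvw. -/
open MvPolynomial

theorem Multiset.esymm_zero_right {R : Type*} [CommSemiring R] (s : Multiset R) :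
    s.esymm 0 = 1 := by
  simp [Multiset.esymm]

theorem Multiset.esymm_zero_succ {R : Type*} [CommSemiring R] (n : ℕ) :
    (0 : Multiset R).esymm (n + 1) = 0 := by
  simp [Multiset.esymm, Multiset.powersetCard_zero_right]

theorem Multiset.esymm_cons_succ {R : Type*} [CommSemiring R] (x : R) (s : Multiset R) (n : ℕ) :
    (x ::ₘ s).esymm (n + 1) = s.esymm (n + 1) + x * s.esymm n := by
  simp [Multiset.esymm, Multiset.powersetCard_cons, Multiset.sum_map_mul_left]

/-- The Chern number identities hold in any commutative ring whose elements `u`, `v`, `w` satisfy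
the relations of the cohomology ring. -/
theorem esymm_rays_of_relations {R : Type*} [CommRing R] (a u v w : R) (hu : u ^ 2 = 0)
    (hv : v ^ 2 = a * u * v) (hw : w ^ 2 = v * w) :
    let rays : Multiset R := {u, u, v - a * u, v, w - v, w}
    rays.esymm 1 ^ 3 = (48 + 2 * a) * (u * v * w) ∧
    rays.esymm 1 * rays.esymm 2 = 24 * (u * v * w) ∧
    rays.esymm 3 = 8 * (u * v * w) := by
  have h (n : ℕ) (x : R) (s : Multiset R) := Multiset.esymm_cons_succ x s n
  simp only [Multiset.insert_eq_cons, ← Multiset.cons_zero, h 0, h 1, h 2,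
    Multiset.esymm_zero_right, Multiset.esymm_zero_succ 0, Multiset.esymm_zero_succ 1,
    Multiset.esymm_zero_succ 2, Nat.reduceAdd, zero_add]
  refine ⟨?_, ?_, ?_⟩ <;> grind

/-- In `R = ℤ[u,v,w]/(u², v² - a·uv, w² - vw)`, the cohomology ring of the toric variety
`X(a)` (a `ℂP¹`-bundle over the Hirzebruch surface), the elementary symmetric functions
`σₖ` of the six ray classes `u, u, v - au, v, w - v, w` satisfy `σ₁³ = (48 + 2a)·uvw`,
`σ₁σ₂ = 24·uvw` and `σ₃ = 8·uvw`, i.e. `c₁³ = 48 + 2a`, `c₁c₂ = 24`, `c₃ = 8`. -/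
theorem stmt_4 (a : ℤ) :
    let I : Ideal (MvPolynomial (Fin 3) ℤ) :=
      Ideal.span {X 0 ^ 2, X 1 ^ 2 - C a * X 0 * X 1, X 2 ^ 2 - X 1 * X 2}
    let u : MvPolynomial (Fin 3) ℤ ⧸ I := Ideal.Quotient.mk I (X 0)
    let v : MvPolynomial (Fin 3) ℤ ⧸ I := Ideal.Quotient.mk I (X 1)
    let w : MvPolynomial (Fin 3) ℤ ⧸ I := Ideal.Quotient.mk I (X 2)
    let rays : Multiset (MvPolynomial (Fin 3) ℤ ⧸ I) :=
      {u, u, v - (a : MvPolynomial (Fin 3) ℤ ⧸ I) * u, v, w - v, w}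
    rays.esymm 1 ^ 3 = (48 + 2 * (a : MvPolynomial (Fin 3) ℤ ⧸ I)) * (u * v * w) ∧
    rays.esymm 1 * rays.esymm 2 = 24 * (u * v * w) ∧
    rays.esymm 3 = 8 * (u * v * w) := by
  intro I u v w
  refine esymm_rays_of_relations (a : MvPolynomial (Fin 3) ℤ ⧸ I) u v w ?_ ?_ ?_
  · rw [← map_pow]
    exact Ideal.Quotient.eq_zero_iff_mem.mpr (Ideal.subset_span (by simp))
  · have h : Ideal.Quotient.mk I (X 1 ^ 2) = Ideal.Quotient.mk I (C a * X 0 * X 1) :=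
      Ideal.Quotient.eq.mpr (Ideal.subset_span (by simp))
    simpa using h
  · have h : Ideal.Quotient.mk I (X 2 ^ 2) = Ideal.Quotient.mk I (X 1 * X 2) :=
      Ideal.Quotient.eq.mpr (Ideal.subset_span (by simp))
    simpa using h
end

section
/- Let e_1,e_2,e_3,e_4 denote the elementary symmetric polynomials in x_1,x_2,x_3,x_4 over ℚ, set y_i = x_i + x_i^2/2 + x_i^3/6 + x_i^4/24 for i=1,...,4, and let Td_4 = 1 + e_1/2 + (e_1^2+e_2)/12 + e_1e_2/24 + (−e_1^4 + 4e_1^2e_2 + 3e_2^2 + e_1e_3 − e_4)/720. Then the homogeneous component of degree 4 of (y_1+y_2+y_3+y_4)·Td_4 equals (1/12)(2e_1^4 − 5e_1^2e_2 + 5e_1e_3 − 2e_4). -/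
open MvPolynomial

/-- The degree-4 component of a product of two sums of homogeneous polynomials. -/
lemma homogeneousComponent_four_mul {σ R : Type*} [CommRing R]
    {p₁ p₂ p₃ p₄ t₀ t₁ t₂ t₃ t₄ : MvPolynomial σ R}
    (hp₁ : p₁.IsHomogeneous 1) (hp₂ : p₂.IsHomogeneous 2)
    (hp₃ : p₃.IsHomogeneous 3) (hp₄ : p₄.IsHomogeneous 4)
    (ht₀ : t₀.IsHomogeneous 0) (ht₁ : t₁.IsHomogeneous 1) (ht₂ : t₂.IsHomogeneous 2)
    (ht₃ : t₃.IsHomogeneous 3) (ht₄ : t₄.IsHomogeneous 4) :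
    homogeneousComponent 4 ((p₁ + p₂ + p₃ + p₄) * (t₀ + t₁ + t₂ + t₃ + t₄)) =
      p₁ * t₃ + p₂ * t₂ + p₃ * t₁ + p₄ * t₀ := by
  have key : ∀ {m n : ℕ} {p t : MvPolynomial σ R}, p.IsHomogeneous m → t.IsHomogeneous n →
      homogeneousComponent 4 (p * t) = if m + n = 4 then p * t else 0 := fun hp ht => by
    simpa [eq_comm] using homogeneousComponent_of_mem (m := 4) (hp.mul ht)
  simp only [add_mul, mul_add, map_add]
  simp [key hp₁ ht₀, key hp₁ ht₁, key hp₁ ht₂, key hp₁ ht₃, key hp₁ ht₄,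
    key hp₂ ht₀, key hp₂ ht₁, key hp₂ ht₂, key hp₂ ht₃, key hp₂ ht₄,
    key hp₃ ht₀, key hp₃ ht₁, key hp₃ ht₂, key hp₃ ht₃, key hp₃ ht₄,
    key hp₄ ht₀, key hp₄ ht₁, key hp₄ ht₂, key hp₄ ht₃, key hp₄ ht₄]
  abel

lemma isHomogeneous_esymm (σ R : Type*) [Fintype σ] [CommRing R] (n : ℕ) :
    (esymm σ R n).IsHomogeneous n := by
  refine IsHomogeneous.sum _ _ _ fun s hs => ?_
  have h := IsHomogeneous.prod s (fun i => (X i : MvPolynomial σ R)) (fun _ => 1)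
    fun i _ => isHomogeneous_X R i
  simpa [(Finset.mem_powersetCard.1 hs).2] using h

lemma isHomogeneous_sum_X_pow (σ R : Type*) [Fintype σ] [CommRing R] (n : ℕ) :
    (∑ i : σ, (X i : MvPolynomial σ R) ^ n).IsHomogeneous n :=
  IsHomogeneous.sum _ _ _ fun i _ => isHomogeneous_X_pow i n

lemma esymm_fin_four_two (R : Type*) [CommRing R] :
    esymm (Fin 4) R 2 = X 0 * X 1 + X 0 * X 2 + X 0 * X 3 + X 1 * X 2 + X 1 * X 3 + X 2 * X 3 := by
  have h : (Finset.univ : Finset (Fin 4)).powersetCard 2 =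
      {{0, 1}, {0, 2}, {0, 3}, {1, 2}, {1, 3}, {2, 3}} := by decide
  rw [esymm, h]
  repeat rw [Finset.sum_insert (by decide)]
  simp
  ring

lemma esymm_fin_four_three (R : Type*) [CommRing R] :
    esymm (Fin 4) R 3 = X 0 * X 1 * X 2 + X 0 * X 1 * X 3 + X 0 * X 2 * X 3 + X 1 * X 2 * X 3 := by
  have h : (Finset.univ : Finset (Fin 4)).powersetCard 3 =
      {{0, 1, 2}, {0, 1, 3}, {0, 2, 3}, {1, 2, 3}} := by decide
  rw [esymm, h]
  repeat rw [Finset.sum_insert (by decide)]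
  simp
  ring

lemma esymm_fin_four_four (R : Type*) [CommRing R] :
    esymm (Fin 4) R 4 = X 0 * X 1 * X 2 * X 3 := by
  have h : (Finset.univ : Finset (Fin 4)).powersetCard 4 = {Finset.univ} := by decide
  rw [esymm, h, Finset.sum_singleton, Fin.prod_univ_four]

/-- κ_{1}[M] in dimension 4: the degree-4 part of σ₁(y)·Td₄ is (1/12)(2e₁⁴ - 5e₁²e₂ + 5e₁e₃ - 2e₄). -/
theorem stmt_5 :
    let y : Fin 4 → MvPolynomial (Fin 4) ℚ := fun i =>
      X i + C (1/2 : ℚ) * X i ^ 2 + C (1/6 : ℚ) * X i ^ 3 + C (1/24 : ℚ) * X i ^ 4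
    let e : ℕ → MvPolynomial (Fin 4) ℚ := esymm (Fin 4) ℚ
    let Td₄ : MvPolynomial (Fin 4) ℚ :=
      1 + C (1/2 : ℚ) * e 1 + C (1/12 : ℚ) * (e 1 ^ 2 + e 2) + C (1/24 : ℚ) * (e 1 * e 2)
        + C (1/720 : ℚ) * (-e 1 ^ 4 + 4 * e 1 ^ 2 * e 2 + 3 * e 2 ^ 2 + e 1 * e 3 - e 4)
    let σ : ℕ → MvPolynomial (Fin 4) ℚ := fun k =>
      ({y 0, y 1, y 2, y 3} : Multiset (MvPolynomial (Fin 4) ℚ)).esymm k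
    (homogeneousComponent 4) ((y 0 + y 1 + y 2 + y 3) * Td₄)
      = C (1/12 : ℚ) * (2 * e 1 ^ 4 - 5 * e 1 ^ 2 * e 2 + 5 * (e 1 * e 3) - 2 * e 4) := by
  intro y e Td₄ σ
  have he : ∀ n, (e n).IsHomogeneous n := isHomogeneous_esymm (Fin 4) ℚ
  have hpow := isHomogeneous_sum_X_pow (Fin 4) ℚ
  have h3 : (e 1 * e 2).IsHomogeneous 3 := (he 1).mul (he 2)
  have h2 : (e 1 ^ 2 + e 2).IsHomogeneous 2 := ((he 1).pow 2).add (he 2)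
  have h4 : (-e 1 ^ 4 + 4 * e 1 ^ 2 * e 2 + 3 * e 2 ^ 2 + e 1 * e 3 - e 4).IsHomogeneous 4 := by
    have h112 : (4 * e 1 ^ 2 * e 2).IsHomogeneous 4 := by
      rw [mul_assoc]
      exact (((he 1).pow 2).mul (he 2)).C_mul 4
    have h22 : (3 * e 2 ^ 2).IsHomogeneous 4 := ((he 2).pow 2).C_mul 3
    exact (((((he 1).pow 4).neg.add h112).add h22).add ((he 1).mul (he 3))).sub (he 4)
  have hy : y 0 + y 1 + y 2 + y 3 = ∑ i : Fin 4, X i ^ 1 + C (1/2 : ℚ) * ∑ i : Fin 4, X i ^ 2 +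
      C (1/6 : ℚ) * ∑ i : Fin 4, X i ^ 3 + C (1/24 : ℚ) * ∑ i : Fin 4, X i ^ 4 := by
    simp only [y, Fin.sum_univ_four]
    ring
  rw [hy, homogeneousComponent_four_mul (hpow 1) ((hpow 2).C_mul _) ((hpow 3).C_mul _)
    ((hpow 4).C_mul _) (isHomogeneous_one _ _) ((he 1).C_mul _) (h2.C_mul _) (h3.C_mul _)
    (h4.C_mul _)]
  have h₂ : (C (1/2 : ℚ) : MvPolynomial (Fin 4) ℚ) = 12 * C (1/24 : ℚ) := by
    rw [← map_ofNat C 12, ← C_mul]; norm_num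
  have h₆ : (C (1/6 : ℚ) : MvPolynomial (Fin 4) ℚ) = 4 * C (1/24 : ℚ) := by
    rw [← map_ofNat C 4, ← C_mul]; norm_num
  have h₁₂ : (C (1/12 : ℚ) : MvPolynomial (Fin 4) ℚ) = 2 * C (1/24 : ℚ) := by
    rw [← map_ofNat C 2, ← C_mul]; norm_num
  have h₁ : (24 : MvPolynomial (Fin 4) ℚ) * C (1/24 : ℚ) = 1 := by
    rw [← map_ofNat C 24, ← C_mul]; norm_num
  have e1 : e 1 = ∑ i : Fin 4, X i := esymm_one _ _
  have e2 : e 2 = _ := esymm_fin_four_two ℚ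
  have e3 : e 3 = _ := esymm_fin_four_three ℚ
  have e4 : e 4 = _ := esymm_fin_four_four ℚ
  have p1 : ∑ i : Fin 4, X i ^ 1 = e 1 := by
    simp [e1]
  have p2 : ∑ i : Fin 4, X i ^ 2 = e 1 ^ 2 - 2 * e 2 := by
    simp only [e1, e2, Fin.sum_univ_four]; ring
  have p3 : ∑ i : Fin 4, X i ^ 3 = e 1 ^ 3 - 3 * e 1 * e 2 + 3 * e 3 := by
    simp only [e1, e2, e3, Fin.sum_univ_four]; ring
  have p4 : ∑ i : Fin 4, X i ^ 4 =
      e 1 ^ 4 - 4 * e 1 ^ 2 * e 2 + 2 * e 2 ^ 2 + 4 * e 1 * e 3 - 4 * e 4 := by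
    simp only [e1, e2, e3, e4, Fin.sum_univ_four]; ring
  rw [p1, p2, p3, p4, h₂, h₆, h₁₂]
  linear_combination
    C (1/24 : ℚ) * ((e 1 ^ 2 - 2 * e 2) * (e 1 ^ 2 + e 2) +
      2 * (e 1 ^ 3 - 3 * e 1 * e 2 + 3 * e 3) * e 1) * h₁
end

section
/- Let e_1,e_2,e_3,e_4 denote the elementary symmetric polynomials in x_1,x_2,x_3,x_4 over ℚ, set y_i = x_i + x_i^2/2 + x_i^3/6 + x_i^4/24 for i=1,...,4, and let Td_4 = 1 + e_1/2 + (e_1^2+e_2)/12 + e_1e_2/24 + (−e_1^4 + 4e_1^2e_2 + 3e_2^2 + e_1e_3 − e_4)/720. Let σ_2(y) denote the second elementary symmetric polynomial evaluated at y_1,...,y_4. Then the homogeneous component of degree 4 of σ_2(y)·Td_4 equals (1/12)(6e_1^2e_2 − 17e_1e_3 + 14e_4). -/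
open MvPolynomial

theorem MvPolynomial.homogeneousComponent_mul {σ R : Type*} [CommSemiring R] (n : ℕ)
    (p q : MvPolynomial σ R) :
    homogeneousComponent n (p * q) =
      ∑ ab ∈ Finset.HasAntidiagonal.antidiagonal n,
        homogeneousComponent ab.1 p * homogeneousComponent ab.2 q := by
  classical
  ext d
  simp only [coeff_homogeneousComponent, coeff_sum, coeff_mul]
  rw [Finset.sum_comm]
  have key : ∀ x ∈ Finset.HasAntidiagonal.antidiagonal d,
      ∑ ab ∈ Finset.HasAntidiagonal.antidiagonal n,
      (if x.1.degree = ab.1 then coeff x.1 p else 0) *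
        (if x.2.degree = ab.2 then coeff x.2 q else 0) =
      if d.degree = n then coeff x.1 p * coeff x.2 q else 0 := by
    intro x hx
    rw [Finset.HasAntidiagonal.mem_antidiagonal] at hx
    have hd : d.degree = x.1.degree + x.2.degree := by rw [← hx, map_add]
    simp only [ite_zero_mul_ite_zero]
    split_ifs with h
    · rw [Finset.sum_eq_single (x.1.degree, x.2.degree)]
      · simp
      · intro b _ hb
        rw [if_neg]
        rintro ⟨h1, h2⟩
        exact hb (Prod.ext h1.symm h2.symm)
      · intro hb
        exact absurd (Finset.HasAntidiagonal.mem_antidiagonal.2 (hd.symm.trans h)) hb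
    · refine Finset.sum_eq_zero fun ab hab => if_neg ?_
      rintro ⟨h1, h2⟩
      rw [Finset.HasAntidiagonal.mem_antidiagonal] at hab
      exact h (by omega)
  rw [Finset.sum_congr rfl key]
  split_ifs <;> simp

theorem MvPolynomial.IsHomogeneous.homogeneousComponent_eq {σ R : Type*} [CommSemiring R]
    {p : MvPolynomial σ R} {m : ℕ} (hp : p.IsHomogeneous m) (n : ℕ) :
    homogeneousComponent n p = if n = m then p else 0 :=
  homogeneousComponent_of_mem hp

theorem MvPolynomial.esymm_isHomogeneous (σ R : Type*) [Fintype σ] [CommSemiring R] (k : ℕ) :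
    (esymm σ R k).IsHomogeneous k := by
  refine IsHomogeneous.sum _ _ _ fun s hs => ?_
  rw [Finset.mem_powersetCard] at hs
  convert IsHomogeneous.prod s (fun i => (X i : MvPolynomial σ R)) (fun _ => 1)
    fun i _ => isHomogeneous_X R i
  simp [hs.2]

/-- κ_{1,1}[M] in dimension 4: the degree-4 part of σ₂(y)·Td₄ is (1/12)(6e₁²e₂ - 17e₁e₃ + 14e₄). -/
theorem stmt_6 :
    let y : Fin 4 → MvPolynomial (Fin 4) ℚ := fun i =>
      X i + C (1/2 : ℚ) * X i ^ 2 + C (1/6 : ℚ) * X i ^ 3 + C (1/24 : ℚ) * X i ^ 4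
    let e : ℕ → MvPolynomial (Fin 4) ℚ := esymm (Fin 4) ℚ
    let Td₄ : MvPolynomial (Fin 4) ℚ :=
      1 + C (1/2 : ℚ) * e 1 + C (1/12 : ℚ) * (e 1 ^ 2 + e 2) + C (1/24 : ℚ) * (e 1 * e 2)
        + C (1/720 : ℚ) * (-e 1 ^ 4 + 4 * e 1 ^ 2 * e 2 + 3 * e 2 ^ 2 + e 1 * e 3 - e 4)
    let σ : ℕ → MvPolynomial (Fin 4) ℚ := fun k =>
      ({y 0, y 1, y 2, y 3} : Multiset (MvPolynomial (Fin 4) ℚ)).esymm k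
    (homogeneousComponent 4) ((σ 2) * Td₄)
      = C (1/12 : ℚ) * (6 * e 1 ^ 2 * e 2 - 17 * (e 1 * e 3) + 14 * e 4) := by
  intro y e Td₄ σ
  have he (k : ℕ) : (e k).IsHomogeneous k := esymm_isHomogeneous (Fin 4) ℚ k
  have hy (n : ℕ) (i : Fin 4) : homogeneousComponent n (y i) =
      (if n = 1 then X i else 0) + C (1/2 : ℚ) * (if n = 2 then X i ^ 2 else 0)
        + C (1/6 : ℚ) * (if n = 3 then X i ^ 3 else 0)
        + C (1/24 : ℚ) * (if n = 4 then X i ^ 4 else 0) := by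
    simp only [y, map_add, homogeneousComponent_C_mul,
      (isHomogeneous_X ℚ i).homogeneousComponent_eq,
      (isHomogeneous_X_pow (R := ℚ) i _).homogeneousComponent_eq]
  have h2 : (e 1 ^ 2 + e 2).IsHomogeneous 2 := ((he 1).pow 2).add (he 2)
  have h3 : (e 1 * e 2).IsHomogeneous 3 := (he 1).mul (he 2)
  have h4 : (-e 1 ^ 4 + 4 * e 1 ^ 2 * e 2 + 3 * e 2 ^ 2 + e 1 * e 3 - e 4).IsHomogeneous 4 := by
    have h := (((((he 1).pow 4).neg.add ((((he 1).pow 2).mul (he 2)).C_mul 4)).add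
      (((he 2).pow 2).C_mul 3)).add ((he 1).mul (he 3))).sub (he 4)
    simp only [map_ofNat, ← mul_assoc] at h
    exact h
  have hTd (n : ℕ) : homogeneousComponent n Td₄ =
      (if n = 0 then 1 else 0) + C (1/2 : ℚ) * (if n = 1 then e 1 else 0)
        + C (1/12 : ℚ) * (if n = 2 then e 1 ^ 2 + e 2 else 0)
        + C (1/24 : ℚ) * (if n = 3 then e 1 * e 2 else 0)
        + C (1/720 : ℚ) * (if n = 4 then
          -e 1 ^ 4 + 4 * e 1 ^ 2 * e 2 + 3 * e 2 ^ 2 + e 1 * e 3 - e 4 else 0) := by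
    simp only [Td₄]
    generalize -e 1 ^ 4 + 4 * e 1 ^ 2 * e 2 + 3 * e 2 ^ 2 + e 1 * e 3 - e 4 = t at h4 ⊢
    generalize e 1 ^ 2 + e 2 = u at h2 ⊢
    simp only [map_add, homogeneousComponent_C_mul,
      (isHomogeneous_one _ _).homogeneousComponent_eq,
      (he 1).homogeneousComponent_eq, h2.homogeneousComponent_eq, h3.homogeneousComponent_eq,
      h4.homogeneousComponent_eq]
  have hσ : σ 2 = y 0 * y 1 + y 0 * y 2 + y 0 * y 3 + y 1 * y 2 + y 1 * y 3 + y 2 * y 3 := by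
    simp [σ, Multiset.insert_eq_cons, ← Multiset.cons_zero, Multiset.esymm,
      Multiset.powersetCard_zero_right]
    ring
  have hX (k : ℕ) : e k = ({X 0, X 1, X 2, X 3} : Multiset (MvPolynomial (Fin 4) ℚ)).esymm k := by
    simp only [e, esymm_eq_multiset_esymm]
    rfl
  have e1 : e 1 = X 0 + X 1 + X 2 + X 3 := by
    rw [hX]
    simp [Multiset.insert_eq_cons, ← Multiset.cons_zero, Multiset.esymm,
      Multiset.powersetCard_zero_right]
    ring
  have e2 : e 2 = X 0 * X 1 + X 0 * X 2 + X 0 * X 3 + X 1 * X 2 + X 1 * X 3 + X 2 * X 3 := by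
    rw [hX]
    simp [Multiset.insert_eq_cons, ← Multiset.cons_zero, Multiset.esymm,
      Multiset.powersetCard_zero_right]
    ring
  have e3 : e 3 = X 0 * X 1 * X 2 + X 0 * X 1 * X 3 + X 0 * X 2 * X 3 + X 1 * X 2 * X 3 := by
    rw [hX]
    simp [Multiset.insert_eq_cons, ← Multiset.cons_zero, Multiset.esymm,
      Multiset.powersetCard_zero_right]
    ring
  have e4 : e 4 = X 0 * X 1 * X 2 * X 3 := by
    rw [hX]
    simp [Multiset.insert_eq_cons, ← Multiset.cons_zero, Multiset.esymm,
      Multiset.powersetCard_zero_right]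
    ring
  rw [hσ, homogeneousComponent_mul]
  simp only [Finset.Nat.antidiagonal_succ, Finset.Nat.antidiagonal_zero, hTd, map_add,
    homogeneousComponent_mul]
  refine MvPolynomial.funext fun x => ?_
  simp [Finset.Nat.antidiagonal_succ, hy, e1, e2, e3, e4]
  ring
end

section
/- Let e_1,e_2,e_3,e_4 denote the elementary symmetric polynomials in x_1,x_2,x_3,x_4 over ℚ, set y_i = x_i + x_i^2/2 + x_i^3/6 + x_i^4/24 for i=1,...,4, and let Td_4 = 1 + e_1/2 + (e_1^2+e_2)/12 + e_1e_2/24 + (−e_1^4 + 4e_1^2e_2 + 3e_2^2 + e_1e_3 − e_4)/720. Let σ_k(y) denote the k-th elementary symmetric polynomial evaluated at y_1,...,y_4. Then the homogeneous component of degree 4 of (σ_1(y)^2 − 2σ_2(y))·Td_4 equals (1/12)(14e_1^4 − 47e_1^2e_2 + 12e_2^2 + 46e_1e_3 − 28e_4). -/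
open MvPolynomial

namespace Multiset

variable {R : Type*} [CommSemiring R] (a b c d : R)

lemma esymm_quadruple_one : ({a, b, c, d} : Multiset R).esymm 1 = a + b + c + d := by
  simp [esymm, insert_eq_cons, ← cons_zero, powersetCard_cons, powersetCard_zero_left,
    powersetCard_one]
  ring

lemma esymm_quadruple_two :
    ({a, b, c, d} : Multiset R).esymm 2 = a * b + a * c + a * d + b * c + b * d + c * d := by
  simp [esymm, insert_eq_cons, ← cons_zero, powersetCard_cons, powersetCard_zero_left,
    powersetCard_one]
  ring

lemma esymm_quadruple_three :
    ({a, b, c, d} : Multiset R).esymm 3 = a * b * c + a * b * d + a * c * d + b * c * d := by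
  simp [esymm, insert_eq_cons, ← cons_zero, powersetCard_cons, powersetCard_zero_left,
    powersetCard_one]
  ring

lemma esymm_quadruple_four : ({a, b, c, d} : Multiset R).esymm 4 = a * b * c * d := by
  simp [esymm, insert_eq_cons, ← cons_zero, powersetCard_cons, powersetCard_zero_left,
    powersetCard_one]
  ring

end Multiset

namespace MvPolynomial

variable {R : Type*} [CommSemiring R]

lemma esymm_fin_four (k : ℕ) :
    esymm (Fin 4) R k = ({X 0, X 1, X 2, X 3} : Multiset (MvPolynomial (Fin 4) R)).esymm k := by
  rw [esymm_eq_multiset_esymm]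
  rfl

lemma isHomogeneous_esymm (σ : Type*) [Fintype σ] (k : ℕ) :
    (esymm σ R k).IsHomogeneous k := by
  refine IsHomogeneous.sum _ _ _ fun s hs => ?_
  rw [← (Finset.mem_powersetCard.1 hs).2, Finset.card_eq_sum_ones]
  exact IsHomogeneous.prod _ _ _ fun i _ => isHomogeneous_X R i

lemma isHomogeneous_psum (σ : Type*) [Fintype σ] (k : ℕ) :
    (psum σ R k).IsHomogeneous k :=
  IsHomogeneous.sum _ _ _ fun i _ => isHomogeneous_X_pow i k

/-- A graded piece of a product of two polynomials given by their homogeneous decompositions. -/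
lemma homogeneousComponent_sum_mul_sum {σ : Type*} {m n : ℕ} (k : ℕ)
    {P : Fin m → MvPolynomial σ R} {Q : Fin n → MvPolynomial σ R}
    (hP : ∀ i, (P i).IsHomogeneous i) (hQ : ∀ j, (Q j).IsHomogeneous j) :
    homogeneousComponent k ((∑ i, P i) * ∑ j, Q j) =
      ∑ i : Fin m, ∑ j : Fin n, if (i : ℕ) + j = k then P i * Q j else 0 := by
  simp only [Finset.sum_mul_sum, map_sum]
  refine Finset.sum_congr rfl fun i _ => Finset.sum_congr rfl fun j _ => ?_
  rw [homogeneousComponent_of_mem ((hP i).mul (hQ j))]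
  simp only [eq_comm]

end MvPolynomial

/-- κ_{2}[M] in dimension 4: the degree-4 part of (σ₁(y)² - 2σ₂(y))·Td₄ is (1/12)(14e₁⁴ - 47e₁²e₂ + 12e₂² + 46e₁e₃ - 28e₄). -/
theorem stmt_7 :
    let y : Fin 4 → MvPolynomial (Fin 4) ℚ := fun i =>
      X i + C (1/2 : ℚ) * X i ^ 2 + C (1/6 : ℚ) * X i ^ 3 + C (1/24 : ℚ) * X i ^ 4
    let e : ℕ → MvPolynomial (Fin 4) ℚ := esymm (Fin 4) ℚ
    let Td₄ : MvPolynomial (Fin 4) ℚ :=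
      1 + C (1/2 : ℚ) * e 1 + C (1/12 : ℚ) * (e 1 ^ 2 + e 2) + C (1/24 : ℚ) * (e 1 * e 2)
        + C (1/720 : ℚ) * (-e 1 ^ 4 + 4 * e 1 ^ 2 * e 2 + 3 * e 2 ^ 2 + e 1 * e 3 - e 4)
    let σ : ℕ → MvPolynomial (Fin 4) ℚ := fun k =>
      ({y 0, y 1, y 2, y 3} : Multiset (MvPolynomial (Fin 4) ℚ)).esymm k
    (homogeneousComponent 4) ((σ 1 ^ 2 - 2 * σ 2) * Td₄)
      = C (1/12 : ℚ) * (14 * e 1 ^ 4 - 47 * e 1 ^ 2 * e 2 + 12 * e 2 ^ 2 + 46 * (e 1 * e 3) - 28 * e 4) := by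
  intro y e Td₄ σ
  have he : ∀ k, (e k).IsHomogeneous k := isHomogeneous_esymm _
  let a : Fin 9 → ℚ := ![0, 0, 1, 1, 7/12, 1/4, 5/72, 1/72, 1/576]
  let P : Fin 9 → MvPolynomial (Fin 4) ℚ := fun i => C (a i) * psum (Fin 4) ℚ i
  let T : Fin 5 → MvPolynomial (Fin 4) ℚ :=
    ![1, C (1/2) * e 1, C (1/12) * (e 1 ^ 2 + e 2), C (1/24) * (e 1 * e 2),
      C (1/720) * (-e 1 ^ 4 + 4 * e 1 ^ 2 * e 2 + 3 * e 2 ^ 2 + e 1 * e 3 - e 4)]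
  have hP : ∀ i, (P i).IsHomogeneous i := fun i => (isHomogeneous_psum _ _).C_mul _
  have hT : ∀ j, (T j).IsHomogeneous j := by
    intro j
    fin_cases j
    · exact isHomogeneous_one _ _
    · exact (he 1).C_mul _
    · exact (((he 1).pow 2).add (he 2)).C_mul _
    · exact ((he 1).mul (he 2)).C_mul _
    · have h4 := (((he 1).pow 2).mul (he 2)).C_mul 4
      have h3 := ((he 2).pow 2).C_mul 3
      simp only [map_ofNat, ← mul_assoc] at h3 h4
      exact ((((((he 1).pow 4).neg.add h4).add h3).add ((he 1).mul (he 3))).sub (he 4)).C_mul _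
  have hσ : σ 1 ^ 2 - 2 * σ 2 = ∑ i, P i := by
    refine MvPolynomial.funext fun x => ?_
    simp only [σ, Multiset.esymm_quadruple_one, Multiset.esymm_quadruple_two]
    simp [y, P, a, psum, Fin.sum_univ_succ]
    ring
  have hTd : Td₄ = ∑ j, T j := by
    simp [Td₄, T, Fin.sum_univ_succ, add_assoc]
  rw [hσ, hTd, homogeneousComponent_sum_mul_sum 4 hP hT]
  have hsum : (∑ i : Fin 9, ∑ j : Fin 5, if (i : ℕ) + j = 4 then P i * T j else 0) =
      P 0 * T 4 + P 1 * T 3 + P 2 * T 2 + P 3 * T 1 + P 4 * T 0 := by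
    simp [Fin.sum_univ_succ, ← add_assoc]
  rw [hsum]
  refine MvPolynomial.funext fun x => ?_
  simp only [P, T, e, esymm_fin_four, Multiset.esymm_quadruple_one, Multiset.esymm_quadruple_two,
    Multiset.esymm_quadruple_three, Multiset.esymm_quadruple_four]
  simp [a, psum, Fin.sum_univ_succ]
  ring
end

section
/- Let e_1,e_2,e_3,e_4 denote the elementary symmetric polynomials in x_1,x_2,x_3,x_4 over ℚ, set y_i = x_i + x_i^2/2 + x_i^3/6 + x_i^4/24 for i=1,...,4, and let Td_4 = 1 + e_1/2 + (e_1^2+e_2)/12 + e_1e_2/24 + (−e_1^4 + 4e_1^2e_2 + 3e_2^2 + e_1e_3 − e_4)/720. Let σ_3(y) denote the third elementary symmetric polynomial evaluated at y_1,...,y_4. Then the homogeneous component of degree 4 of σ_3(y)·Td_4 equals e_1e_3 − 2e_4. -/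
open MvPolynomial

theorem Multiset.esymm_quadruple_one_s8 {R : Type*} [CommRing R] (a b c d : R) :
    ({a, b, c, d} : Multiset R).esymm 1 = a + b + c + d := by
  simp [Multiset.esymm, Multiset.powersetCard_one]
  ring

theorem Multiset.esymm_quadruple_two_s8 {R : Type*} [CommRing R] (a b c d : R) :
    ({a, b, c, d} : Multiset R).esymm 2 = a * b + a * c + a * d + b * c + b * d + c * d := by
  simp [Multiset.esymm, Multiset.powersetCard_cons, Multiset.powersetCard_one]
  ring

theorem Multiset.esymm_quadruple_three_s8 {R : Type*} [CommRing R] (a b c d : R) :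
    ({a, b, c, d} : Multiset R).esymm 3 = a * b * c + a * b * d + a * c * d + b * c * d := by
  simp [Multiset.esymm, Multiset.powersetCard_cons, Multiset.powersetCard_one]
  ring

theorem Multiset.esymm_quadruple_four_s8 {R : Type*} [CommRing R] (a b c d : R) :
    ({a, b, c, d} : Multiset R).esymm 4 = a * b * c * d := by
  simp [Multiset.esymm, Multiset.powersetCard_cons, Multiset.powersetCard_one]
  ring

theorem MvPolynomial.esymm_fin_four_s8 {R : Type*} [CommRing R] (k : ℕ) :
    esymm (Fin 4) R k =
      ({X 0, X 1, X 2, X 3} : Multiset (MvPolynomial (Fin 4) R)).esymm k := by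
  rw [esymm_eq_multiset_esymm]
  rfl

theorem MvPolynomial.IsHomogeneous.esymm {σ R : Type*} [Fintype σ] [CommSemiring R] (k : ℕ) :
    (MvPolynomial.esymm σ R k).IsHomogeneous k := by
  refine IsHomogeneous.sum _ _ _ fun s hs => ?_
  have h := IsHomogeneous.prod s (fun i => (X i : MvPolynomial σ R)) (fun _ => 1)
    fun i _ => isHomogeneous_X R i
  simpa [(Finset.mem_powersetCard.mp hs).2] using h

theorem MvPolynomial.homogeneousComponent_eq_zero_of_mem_pow_idealOfVars
    {σ R : Type*} [CommRing R] {m n : ℕ} (hmn : m < n) {p : MvPolynomial σ R}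
    (hp : p ∈ idealOfVars σ R ^ n) : homogeneousComponent m p = 0 := by
  refine homogeneousComponent_eq_zero' m p fun d hd hdm => ?_
  exact (mem_support_iff.mp hd) ((mem_pow_idealOfVars_iff' n p).mp hp d (by omega))

/-- A product of three series `x + h * x ^ 2 + ⋯` agrees with its two lowest-order terms
up to order five. -/
theorem Ideal.mul_mul_sub_mem_pow_five {R : Type*} [CommRing R] {I : Ideal R} {a b c : R}
    (ha : a ∈ I) (hb : b ∈ I) (hc : c ∈ I) (h p q : R) :
    (a + h * a ^ 2 + p * a ^ 3 + q * a ^ 4) * (b + h * b ^ 2 + p * b ^ 3 + q * b ^ 4) *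
      (c + h * c ^ 2 + p * c ^ 3 + q * c ^ 4) - a * b * c * (1 + h * (a + b + c)) ∈ I ^ 5 := by
  have hmul {x y : R} (hx : x ∈ I) (hy : y ∈ I) : x * y ∈ I ^ 2 :=
    pow_two I ▸ Ideal.mul_mem_mul hx hy
  have h3 : a * b * c ∈ I ^ 3 := pow_succ I 2 ▸ Ideal.mul_mem_mul (hmul ha hb) hc
  have h2 : (1 + h * b + p * b ^ 2 + q * b ^ 3) * (1 + h * c + p * c ^ 2 + q * c ^ 3) *
        (p + q * a) * (a * a)
      + (1 + h * a) * (1 + h * c + p * c ^ 2 + q * c ^ 3) * (p + q * b) * (b * b)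
      + (1 + h * a) * (1 + h * b) * (p + q * c) * (c * c)
      + h ^ 2 * (1 + h * c) * (a * b) + h ^ 2 * (a * c) + h ^ 2 * (b * c) ∈ I ^ 2 := by
    repeat' apply Ideal.add_mem
    all_goals exact Ideal.mul_mem_left _ _ (hmul ‹_› ‹_›)
  convert pow_add I 3 2 ▸ Ideal.mul_mem_mul h3 h2 using 1
  ring



/-- κ_{1,1,1}[M] in dimension 4: the degree-4 part of σ₃(y)·Td₄ is e₁e₃ - 2e₄, an integral class. -/
theorem stmt_8 :
    let y : Fin 4 → MvPolynomial (Fin 4) ℚ := fun i =>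
      X i + C (1/2 : ℚ) * X i ^ 2 + C (1/6 : ℚ) * X i ^ 3 + C (1/24 : ℚ) * X i ^ 4
    let e : ℕ → MvPolynomial (Fin 4) ℚ := esymm (Fin 4) ℚ
    let Td₄ : MvPolynomial (Fin 4) ℚ :=
      1 + C (1/2 : ℚ) * e 1 + C (1/12 : ℚ) * (e 1 ^ 2 + e 2) + C (1/24 : ℚ) * (e 1 * e 2)
        + C (1/720 : ℚ) * (-e 1 ^ 4 + 4 * e 1 ^ 2 * e 2 + 3 * e 2 ^ 2 + e 1 * e 3 - e 4)
    let σ : ℕ → MvPolynomial (Fin 4) ℚ := fun k =>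
      ({y 0, y 1, y 2, y 3} : Multiset (MvPolynomial (Fin 4) ℚ)).esymm k
    (homogeneousComponent 4) ((σ 3) * Td₄)
      = e 1 * e 3 - 2 * e 4 := by
  intro y e Td₄ σ
  set I := idealOfVars (Fin 4) ℚ
  have hX (i : Fin 4) : (X i : MvPolynomial (Fin 4) ℚ) ∈ I :=
    Ideal.subset_span (Set.mem_range_self i)
  have hXX (i j : Fin 4) : (X i * X j : MvPolynomial (Fin 4) ℚ) ∈ I ^ 2 :=
    pow_two I ▸ Ideal.mul_mem_mul (hX i) (hX j)
  have e1 : e 1 = X 0 + X 1 + X 2 + X 3 :=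
    (esymm_fin_four_s8 1).trans (Multiset.esymm_quadruple_one_s8 _ _ _ _)
  have e2 : e 2 = X 0 * X 1 + X 0 * X 2 + X 0 * X 3 + X 1 * X 2 + X 1 * X 3 + X 2 * X 3 :=
    (esymm_fin_four_s8 2).trans (Multiset.esymm_quadruple_two_s8 _ _ _ _)
  have e3 : e 3 = X 0 * X 1 * X 2 + X 0 * X 1 * X 3 + X 0 * X 2 * X 3 + X 1 * X 2 * X 3 :=
    (esymm_fin_four_s8 3).trans (Multiset.esymm_quadruple_three_s8 _ _ _ _)
  have e4 : e 4 = X 0 * X 1 * X 2 * X 3 :=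
    (esymm_fin_four_s8 4).trans (Multiset.esymm_quadruple_four_s8 _ _ _ _)
  have he (k : ℕ) : (e k).IsHomogeneous k := IsHomogeneous.esymm k
  have h1 : e 1 ∈ I := by
    rw [e1]
    exact I.add_mem (I.add_mem (I.add_mem (hX 0) (hX 1)) (hX 2)) (hX 3)
  have h11 : e 1 * e 1 ∈ I ^ 2 := pow_two I ▸ Ideal.mul_mem_mul h1 h1
  have h2 : e 2 ∈ I ^ 2 := by
    rw [e2]
    repeat' apply Ideal.add_mem
    all_goals apply hXX
  have h3 : e 3 ∈ I ^ 3 := by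
    rw [e3]
    repeat' apply Ideal.add_mem
    all_goals exact pow_succ I 2 ▸ Ideal.mul_mem_mul (hXX _ _) (hX _)
  have h4 : e 4 ∈ I ^ 4 := by
    rw [e4, mul_assoc (X 0 * X 1)]
    exact pow_add I 2 2 ▸ Ideal.mul_mem_mul (hXX _ _) (hXX _ _)
  have hTd : Td₄ - (1 + C (1/2) * e 1) ∈ I ^ 2 := by
    have h := (I ^ 2).add_mem (I ^ 2 |>.add_mem (I ^ 2 |>.add_mem
      ((I ^ 2).mul_mem_left (C (1/12) + C (1/720) * (-e 1 ^ 2 + 4 * e 2)) h11)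
      ((I ^ 2).mul_mem_left (C (1/12) + C (1/24) * e 1 + C (1/720) * 3 * e 2) h2))
      ((I ^ 2).mul_mem_left (C (1/720) * e 1) (Ideal.pow_le_pow_right (by norm_num) h3)))
      ((I ^ 2).mul_mem_left (-C (1/720)) (Ideal.pow_le_pow_right (by norm_num) h4))
    convert h using 1
    ring
  have hhalf : (C (1/2) : MvPolynomial (Fin 4) ℚ) * 2 = 1 := by
    rw [← map_ofNat C 2, ← C_mul]
    norm_num
  have hσ : σ 3 - (e 3 + C (1/2) * (e 1 * e 3 - 4 * e 4)) ∈ I ^ 5 := by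
    have hy (i j k : Fin 4) := Ideal.mul_mul_sub_mem_pow_five (hX i) (hX j) (hX k)
      (C (1/2)) (C (1/6)) (C (1/24))
    convert (I ^ 5).add_mem ((I ^ 5).add_mem ((I ^ 5).add_mem (hy 0 1 2) (hy 0 1 3)) (hy 0 2 3))
      (hy 1 2 3) using 1
    simp only [σ, Multiset.esymm_quadruple_three_s8, e1, e3, e4, y]
    ring
  have key : σ 3 * Td₄ - (e 3 + (e 1 * e 3 - 2 * e 4)) ∈ I ^ 5 := by
    have h14 : e 1 * (e 1 * e 3 - 4 * e 4) ∈ I ^ 5 := by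
      have h13 : e 1 * e 3 ∈ I ^ 4 := pow_succ' I 3 ▸ Ideal.mul_mem_mul h1 h3
      exact pow_succ' I 4 ▸
        Ideal.mul_mem_mul h1 (Ideal.sub_mem _ h13 (Ideal.mul_mem_left _ _ h4))
    have h34 : e 3 + C (1/2) * (e 1 * e 3 - 4 * e 4) ∈ I ^ 3 :=
      Ideal.add_mem _ h3 (Ideal.mul_mem_left _ _ (Ideal.sub_mem _ (Ideal.mul_mem_left _ _ h3)
        (Ideal.mul_mem_left _ _ (Ideal.pow_le_pow_right (by norm_num) h4))))
    have h := (I ^ 5).add_mem ((I ^ 5).add_mem ((I ^ 5).mul_mem_left Td₄ hσ)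
      (pow_add I 3 2 ▸ Ideal.mul_mem_mul h34 hTd)) ((I ^ 5).mul_mem_left (C (1/2) * C (1/2)) h14)
    convert h using 1
    linear_combination (e 1 * e 3 - 2 * e 4) * hhalf
  have h0 := homogeneousComponent_eq_zero_of_mem_pow_idealOfVars (m := 4) (by norm_num) key
  have hhom : (e 1 * e 3 - 2 * e 4).IsHomogeneous 4 := by
    refine ((he 1).mul (he 3)).sub ?_
    rw [← map_ofNat C 2]
    exact (he 4).C_mul 2
  rw [map_sub, map_add, homogeneousComponent_of_mem (he 3), homogeneousComponent_eq_self hhom,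
    if_neg (by norm_num), zero_add, sub_eq_zero] at h0
  exact h0
end

section
/- Let R = ℤ[h,e]/(he, e^3 − h^3). Consider the five elements r_1 = r_2 = r_3 = h − e, r_4 = h, r_5 = e of R, and let σ_k denote the k-th elementary symmetric polynomial evaluated at these five elements. Then in R: σ_1^3 = 56·h^3, σ_1·σ_2 = 24·h^3, and σ_3 = 6·h^3. -/
open MvPolynomial

theorem chern_identities_of_mul_eq_zero_of_cube_eq {A : Type*} [CommRing A] {h e : A}
    (hmul : h * e = 0) (hcube : e ^ 3 = h ^ 3) :
    ({h - e, h - e, h - e, h, e} : Multiset A).esymm 1 ^ 3 = 56 * h ^ 3 ∧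
    ({h - e, h - e, h - e, h, e} : Multiset A).esymm 1 *
      ({h - e, h - e, h - e, h, e} : Multiset A).esymm 2 = 24 * h ^ 3 ∧
    ({h - e, h - e, h - e, h, e} : Multiset A).esymm 3 = 6 * h ^ 3 := by
  have esymm_one : ({h - e, h - e, h - e, h, e} : Multiset A).esymm 1 = 4 * h - 2 * e := by
    simp [Multiset.esymm, Multiset.powersetCard_one]
    ring
  have esymm_two :
      ({h - e, h - e, h - e, h, e} : Multiset A).esymm 2 = 6 * h ^ 2 - 5 * (h * e) := by
    simp [Multiset.esymm, Multiset.insert_eq_cons, ← Multiset.cons_zero,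
      Multiset.powersetCard_cons, Multiset.powersetCard_one]
    ring
  have esymm_three : ({h - e, h - e, h - e, h, e} : Multiset A).esymm 3 =
      (h - e) ^ 3 + 3 * (h - e) ^ 2 * (h + e) + 3 * (h - e) * (h * e) := by
    simp [Multiset.esymm, Multiset.insert_eq_cons, ← Multiset.cons_zero,
      Multiset.powersetCard_cons, Multiset.powersetCard_one]
    ring
  rw [esymm_one, esymm_two, esymm_three]
  refine ⟨?_, ?_, ?_⟩
  · linear_combination (-96 * h + 48 * e) * hmul - 8 * hcube
  · linear_combination (-32 * h + 10 * e) * hmul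
  · linear_combination (-3 * h - 3 * e) * hmul + 2 * hcube

/-- In `R = ℤ[h,e]/(he, e³ - h³)`, the cohomology ring of the blow-up `X₂` of `ℂP³` at a
torus-fixed point, the elementary symmetric functions `σₖ` of the five ray classes
`h - e, h - e, h - e, h, e` satisfy `σ₁³ = 56·h³`, `σ₁σ₂ = 24·h³` and `σ₃ = 6·h³`,
i.e. `c₁³[X₂] = 56`, `c₁c₂[X₂] = 24`, `c₃[X₂] = 6`. -/
theorem stmt_17 :
    let I : Ideal (MvPolynomial (Fin 2) ℤ) :=
      Ideal.span {X 0 * X 1, X 1 ^ 3 - X 0 ^ 3}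
    let h : MvPolynomial (Fin 2) ℤ ⧸ I := Ideal.Quotient.mk I (X 0)
    let e : MvPolynomial (Fin 2) ℤ ⧸ I := Ideal.Quotient.mk I (X 1)
    let rays : Multiset (MvPolynomial (Fin 2) ℤ ⧸ I) := {h - e, h - e, h - e, h, e}
    rays.esymm 1 ^ 3 = 56 * h ^ 3 ∧
    rays.esymm 1 * rays.esymm 2 = 24 * h ^ 3 ∧
    rays.esymm 3 = 6 * h ^ 3 := by
  intro I h e rays
  have hmul : h * e = 0 := by
    rw [← map_mul]
    exact Ideal.Quotient.eq_zero_iff_mem.mpr (Ideal.subset_span (by simp))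
  have hcube : e ^ 3 = h ^ 3 := by
    rw [← map_pow, ← map_pow]
    exact Ideal.Quotient.eq.mpr (Ideal.subset_span (by simp))
  exact chern_identities_of_mul_eq_zero_of_cube_eq hmul hcube
end
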